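/- Under the described setup, suppose additionally that there exists ε ≥ 0 such that |E[r(a) | X] − f*(X, a)| ≤ ε almost surely for every a ∈ 𝒜 (ε-misspecification). Then (1/k)·Σ_{a ∈ 𝒜} E[(f(X,a) − f*(X,a))²·χ(a)] ≤ 2·E[Y] + 4·ε². -/

import Mathlib

open MeasureTheory ProbabilityTheory

/-- The conditional expectation of a product of conditionally independent random variables is the
product of their conditional expectations. -/
theorem ProbabilityTheory.CondIndepFun.condExp_mul
    {Ω : Type*} {m mΩ : MeasurableSpace Ω} [StandardBorelSpace Ω] {hm : m ≤ mΩ}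
    {μ : Measure Ω} [IsFiniteMeasure μ] {u v : Ω → ℝ}
    (h : CondIndepFun m hm u v μ) (hu : Measurable u) (hv : Measurable v)
    (hu_int : Integrable u μ) (hv_int : Integrable v μ) (huv_int : Integrable (u * v) μ) :
    μ[u * v | m] =ᵐ[μ] μ[u | m] * μ[v | m] := by
  have hlaw := ae_of_ae_trim hm ((condIndepFun_iff_map_prod_eq_prod_map_map hu hv).1 h)
  filter_upwards [hlaw, condExp_ae_eq_integral_condExpKernel hm hu_int,
    condExp_ae_eq_integral_condExpKernel hm hv_int,
    condExp_ae_eq_integral_condExpKernel hm huv_int] with ω hω hωu hωv hωuv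
  rw [Kernel.map_apply _ (by fun_prop), Kernel.prod_apply, Kernel.map_apply _ hu,
    Kernel.map_apply _ hv] at hω
  have hindep : IndepFun u v (condExpKernel μ m ω) :=
    (indepFun_iff_map_prod_eq_prod_map_map hu.aemeasurable hv.aemeasurable).2 hω
  rw [Pi.mul_apply, hωu, hωv, hωuv]
  exact hindep.integral_mul_eq_mul_integral hu.aestronglyMeasurable hv.aestronglyMeasurable

/-- If `u` and `v` are conditionally independent given `m`, then inside an integral against an
`m`-measurable weight `d`, the factor `v` of `u * v` may be replaced by `μ[v | m]`. -/
theorem ProbabilityTheory.CondIndepFun.integral_mul_mul_condExp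
    {Ω : Type*} {m mΩ : MeasurableSpace Ω} [StandardBorelSpace Ω] {hm : m ≤ mΩ}
    {μ : Measure Ω} [IsFiniteMeasure μ] {d u v : Ω → ℝ}
    (h : CondIndepFun m hm u v μ) (hd : StronglyMeasurable[m] d)
    (hu : Measurable u) (hv : Measurable v)
    (hu_int : Integrable u μ) (hv_int : Integrable v μ) (huv_int : Integrable (u * v) μ)
    (huv'_int : Integrable (u * μ[v | m]) μ) (hduv_int : Integrable (d * (u * v)) μ)
    (hduv'_int : Integrable (d * (u * μ[v | m])) μ) :
    ∫ ω, d ω * (u ω * v ω) ∂μ = ∫ ω, d ω * (u ω * (μ[v | m]) ω) ∂μ := by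
  have hcond : μ[d * (u * v) | m] =ᵐ[μ] μ[d * (u * μ[v | m]) | m] := by
    filter_upwards [condExp_mul_of_stronglyMeasurable_left hd hduv_int huv_int,
      condExp_mul_of_stronglyMeasurable_left hd hduv'_int huv'_int,
      h.condExp_mul hu hv hu_int hv_int huv_int,
      condExp_mul_of_stronglyMeasurable_right stronglyMeasurable_condExp huv'_int hu_int]
      with ω h₁ h₂ h₃ h₄
    rw [h₁, h₂, Pi.mul_apply, Pi.mul_apply, h₃, h₄]
  calc ∫ ω, d ω * (u ω * v ω) ∂μ = ∫ ω, (μ[d * (u * v) | m]) ω ∂μ := (integral_condExp hm).symm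
    _ = ∫ ω, (μ[d * (u * μ[v | m]) | m]) ω ∂μ := integral_congr_ae hcond
    _ = ∫ ω, d ω * (u ω * (μ[v | m]) ω) ∂μ := integral_condExp hm

/-- The weighted squared distance of `p` to `q` is controlled by the excess squared loss of `p`
over `q` when the conditional mean of the target `r` is within `ε` of `q`. -/
theorem integral_sq_sub_mul_le_excess_loss
    {Ω : Type*} {m mΩ : MeasurableSpace Ω} [StandardBorelSpace Ω] {hm : m ≤ mΩ}
    {μ : Measure Ω} [IsFiniteMeasure μ] {p q r χ : Ω → ℝ} {ε : ℝ}
    (h : CondIndepFun m hm χ r μ)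
    (hp : Measurable[m] p) (hq : Measurable[m] q) (hr : Measurable r) (hχ : Measurable χ)
    (hp01 : ∀ ω, p ω ∈ Set.Icc (0 : ℝ) 1) (hq01 : ∀ ω, q ω ∈ Set.Icc (0 : ℝ) 1)
    (hr01 : ∀ ω, r ω ∈ Set.Icc (0 : ℝ) 1) (hχ01 : ∀ ω, χ ω ∈ Set.Icc (0 : ℝ) 1)
    (hε : ∀ᵐ ω ∂μ, |(μ[r | m]) ω - q ω| ≤ ε) :
    ∫ ω, (p ω - q ω) ^ 2 * χ ω ∂μ ≤
      2 * ∫ ω, ((p ω - r ω) ^ 2 - (q ω - r ω) ^ 2) * χ ω ∂μ + 4 * ε ^ 2 * ∫ ω, χ ω ∂μ := by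
  have hp' : Measurable p := hp.mono hm le_rfl
  have hq' : Measurable q := hq.mono hm le_rfl
  have hχ_int : Integrable χ μ := .of_mem_Icc 0 1 hχ.aemeasurable (.of_forall hχ01)
  have hr_int : Integrable r μ := .of_mem_Icc 0 1 hr.aemeasurable (.of_forall hr01)
  have hχ_bdd : ∀ᵐ ω ∂μ, ‖χ ω‖ ≤ 1 := .of_forall fun ω => by
    rw [Real.norm_eq_abs, abs_of_nonneg (hχ01 ω).1]
    exact (hχ01 ω).2
  have hχr_int : Integrable (χ * r) μ := hr_int.bdd_mul hχ.aestronglyMeasurable hχ_bdd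
  have hχr'_int : Integrable (χ * μ[r | m]) μ :=
    integrable_condExp.bdd_mul hχ.aestronglyMeasurable hχ_bdd
  have hd_bdd : ∀ᵐ ω ∂μ, ‖(p - q) ω‖ ≤ 1 := .of_forall fun ω => by
    rw [Real.norm_eq_abs, abs_le, Pi.sub_apply]
    constructor <;> linarith [(hp01 ω).1, (hp01 ω).2, (hq01 ω).1, (hq01 ω).2]
  have hs_bdd : ∀ᵐ ω ∂μ, ‖(p + q) ω‖ ≤ 2 := .of_forall fun ω => by
    rw [Real.norm_eq_abs, abs_le, Pi.add_apply]
    constructor <;> linarith [(hp01 ω).1, (hp01 ω).2, (hq01 ω).1, (hq01 ω).2]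
  have hd_meas : AEStronglyMeasurable (p - q) μ := (hp'.sub hq').aestronglyMeasurable
  have hdχr_int : Integrable ((p - q) * (χ * r)) μ := hχr_int.bdd_mul hd_meas hd_bdd
  have hdχr'_int : Integrable ((p - q) * (χ * μ[r | m])) μ := hχr'_int.bdd_mul hd_meas hd_bdd
  have hdsχ_int : Integrable ((p - q) * ((p + q) * χ)) μ :=
    (hχ_int.bdd_mul (hp'.add hq').aestronglyMeasurable hs_bdd).bdd_mul hd_meas hd_bdd
  have hddχ_int : Integrable ((p - q) * ((p - q) * χ)) μ :=
    (hχ_int.bdd_mul hd_meas hd_bdd).bdd_mul hd_meas hd_bdd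
  have hswap : ∫ ω, ((p - q) * (χ * r)) ω ∂μ = ∫ ω, ((p - q) * (χ * μ[r | m])) ω ∂μ :=
    h.integral_mul_mul_condExp (hp.sub hq).stronglyMeasurable hχ hr hχ_int hr_int
      hχr_int hχr'_int hdχr_int hdχr'_int
  have hloss : ∫ ω, ((p ω - r ω) ^ 2 - (q ω - r ω) ^ 2) * χ ω ∂μ =
      ∫ ω, ((p - q) * ((p + q) * χ)) ω - 2 * ((p - q) * (χ * μ[r | m])) ω ∂μ := by
    rw [integral_sub hdsχ_int (hdχr'_int.const_mul 2), integral_const_mul]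
    rw [← hswap, ← integral_const_mul, ← integral_sub hdsχ_int (hdχr_int.const_mul 2)]
    congr 1 with ω
    simp only [Pi.mul_apply, Pi.sub_apply, Pi.add_apply]
    ring
  have hrhs_int : Integrable (fun ω => ((p - q) * ((p + q) * χ)) ω -
      2 * ((p - q) * (χ * μ[r | m])) ω) μ := hdsχ_int.sub (hdχr'_int.const_mul 2)
  rw [hloss, ← integral_const_mul, ← integral_const_mul,
    ← integral_add (hrhs_int.const_mul 2) (hχ_int.const_mul _)]
  refine integral_mono_ae (hddχ_int.congr (.of_forall fun ω => ?_))
    ((hrhs_int.const_mul 2).add (hχ_int.const_mul _)) ?_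
  · simp only [Pi.mul_apply, Pi.sub_apply]
    ring
  filter_upwards [hε] with ω hω
  simp only [Pi.mul_apply, Pi.sub_apply, Pi.add_apply]
  have hsq := sq_le_sq' (abs_le.1 hω).1 (abs_le.1 hω).2
  nlinarith [mul_nonneg (hχ01 ω).1 (sub_nonneg.2 hsq),
    mul_nonneg (hχ01 ω).1 (sq_nonneg (p ω - q ω - 2 * ((μ[r | m]) ω - q ω)))]

/-- Lower bound on the mean of the per-round excess-loss random variable in the misspecified
setting: if `|E[r(a) | X] - f*(X, a)| ≤ ε` a.s. for every arm `a`, then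
`(1/k) Σ_a E[(f(X,a) - f*(X,a))² χ(a)] ≤ 2 E[Y] + 4 ε²`. -/
theorem excess_loss_mean_misspecified
    {Ω 𝒳 α : Type*} [MeasurableSpace Ω] [StandardBorelSpace Ω] [Nonempty Ω]
    [MeasurableSpace 𝒳] [Fintype α]
    (μ : Measure Ω) [IsProbabilityMeasure μ]
    (k : ℕ) (hk : 1 ≤ k)
    (X : Ω → 𝒳) (hX : Measurable X)
    (r : α → Ω → ℝ) (hr_meas : ∀ a, Measurable (r a))
    (hr01 : ∀ a ω, r a ω ∈ Set.Icc (0 : ℝ) 1)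
    (χ : α → Ω → ℝ) (hχ_meas : ∀ a, Measurable (χ a))
    (hχ01 : ∀ a ω, χ a ω = 0 ∨ χ a ω = 1)
    (hsum : ∀ᵐ ω ∂μ, ∑ a : α, χ a ω ≤ (k : ℝ))
    (hcondindep : ∀ a : α, CondIndepFun (MeasurableSpace.comap X inferInstance)
      hX.comap_le (χ a) (r a) μ)
    (f fstar : 𝒳 → α → ℝ)
    (hf_meas : ∀ a, Measurable fun x => f x a)
    (hfstar_meas : ∀ a, Measurable fun x => fstar x a)
    (hf01 : ∀ x a, f x a ∈ Set.Icc (0 : ℝ) 1)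
    (hfstar01 : ∀ x a, fstar x a ∈ Set.Icc (0 : ℝ) 1)
    (ε : ℝ) (hε : 0 ≤ ε)
    (hmisspec : ∀ a : α, ∀ᵐ ω ∂μ,
      |(μ[r a | MeasurableSpace.comap X inferInstance]) ω - fstar (X ω) a| ≤ ε)
    (Y : Ω → ℝ)
    (hY : Y = fun ω => (1 / (k : ℝ)) *
      ∑ a : α, ((f (X ω) a - r a ω) ^ 2 - (fstar (X ω) a - r a ω) ^ 2) * χ a ω) :
    (1 / (k : ℝ)) * ∑ a : α, ∫ ω, (f (X ω) a - fstar (X ω) a) ^ 2 * χ a ω ∂μ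
      ≤ 2 * (∫ ω, Y ω ∂μ) + 4 * ε ^ 2 := by
  have hk0 : (0 : ℝ) < k := by exact_mod_cast hk
  have hχIcc : ∀ a ω, χ a ω ∈ Set.Icc (0 : ℝ) 1 := fun a ω => by
    rcases hχ01 a ω with h | h <;> simp [h]
  have hX' : Measurable[MeasurableSpace.comap X inferInstance] X := comap_measurable X
  have harm := fun a => integral_sq_sub_mul_le_excess_loss (hcondindep a)
    ((hf_meas a).comp hX') ((hfstar_meas a).comp hX') (hr_meas a) (hχ_meas a)
    (fun ω => hf01 (X ω) a) (fun ω => hfstar01 (X ω) a) (hr01 a) (hχIcc a) (hmisspec a)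
  have hχ_int : ∀ a, Integrable (χ a) μ := fun a =>
    .of_mem_Icc 0 1 (hχ_meas a).aemeasurable (.of_forall (hχIcc a))
  have hχ_sum : ∑ a, ∫ ω, χ a ω ∂μ ≤ k := by
    rw [← integral_finsetSum _ fun a _ => hχ_int a]
    simpa using integral_mono_ae (integrable_finsetSum _ fun a _ => hχ_int a)
      (integrable_const (k : ℝ)) hsum
  have hloss_int : ∀ a, Integrable
      (fun ω => ((f (X ω) a - r a ω) ^ 2 - (fstar (X ω) a - r a ω) ^ 2) * χ a ω) μ := fun a => by
    have hfX := (hf_meas a).comp hX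
    have hfstarX := (hfstar_meas a).comp hX
    refine (hχ_int a).bdd_mul (c := 1) (((hfX.sub (hr_meas a)).pow_const 2).sub
      ((hfstarX.sub (hr_meas a)).pow_const 2)).aestronglyMeasurable (.of_forall fun ω => ?_)
    have h₁ := hf01 (X ω) a
    have h₂ := hfstar01 (X ω) a
    have h₃ := hr01 a ω
    rw [Real.norm_eq_abs, abs_le]
    constructor <;> nlinarith [h₁.1, h₁.2, h₂.1, h₂.2, h₃.1, h₃.2]
  have hY_int : ∫ ω, Y ω ∂μ = 1 / (k : ℝ) * ∑ a, ∫ ω,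
      ((f (X ω) a - r a ω) ^ 2 - (fstar (X ω) a - r a ω) ^ 2) * χ a ω ∂μ := by
    rw [hY, integral_const_mul, integral_finsetSum _ fun a _ => hloss_int a]
  have htotal := Finset.sum_le_sum fun a (_ : a ∈ Finset.univ) => harm a
  simp only [Function.comp_apply, Finset.sum_add_distrib, ← Finset.mul_sum] at htotal
  rw [hY_int, one_div, inv_mul_le_iff₀ hk0]
  refine htotal.trans ?_
  field_simp
  nlinarith [mul_le_mul_of_nonneg_left hχ_sum (sq_nonneg ε)]
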